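/- With the same setup, E[(log(1−F0(Y)))²] = γ²·k·B(α−1, β+1)·((ψ(α−1)−ψ(α+β))² + ψ'(α−1) − ψ'(α+β)). -/

import Mathlib

open MeasureTheory ProbabilityTheory Real

/-- The digamma function `ψ = (log Γ)'`. -/
noncomputable def digamma (x : ℝ) : ℝ := deriv (fun t => Real.log (Real.Gamma t)) x

/-- The trigamma function `ψ'`. -/
noncomputable def trigamma (x : ℝ) : ℝ := deriv digamma x

/-- The Beta function `B(α, β) = Γ(α) Γ(β) / Γ(α + β)`. -/
noncomputable def betaFn (a b : ℝ) : ℝ := Real.Gamma a * Real.Gamma b / Real.Gamma (a + b)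

open Set Filter Topology in
lemma aux_beta (a b : ℝ) (ha : 0 < a) (hb : 0 < b) :
    ∫⁻ u in Ioo (0:ℝ) 1, ENNReal.ofReal (u ^ (a - 1) * (1 - u) ^ (b - 1))
      = ENNReal.ofReal (betaFn a b) := by
  have h := lintegral_betaPDF_eq_one ha hb
  have hB := beta_pos ha hb
  rw [lintegral_betaPDF] at h
  simp_rw [mul_assoc] at h
  simp_rw [ENNReal.ofReal_mul (one_div_pos.2 hB).le] at h
  rw [lintegral_const_mul' _ _ ENNReal.ofReal_ne_top] at h
  have e : betaFn a b = beta a b := rfl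
  rw [e]
  have h2 : ENNReal.ofReal (beta a b) * ENNReal.ofReal (1 / beta a b) = 1 := by
    rw [← ENNReal.ofReal_mul hB.le, mul_one_div_cancel hB.ne', ENNReal.ofReal_one]
  calc _ = (ENNReal.ofReal (beta a b) * ENNReal.ofReal (1 / beta a b)) *
        ∫⁻ u in Ioo (0:ℝ) 1, ENNReal.ofReal (u ^ (a - 1) * (1 - u) ^ (b - 1)) := by
          rw [h2, one_mul]
    _ = _ := by rw [mul_assoc, h, mul_one]

open Set Filter Topology in
lemma aux_cov (γ : ℝ) (hγ : 0 < γ) (k : ℝ) (hk : 0 ≤ k) (a b t : ℝ)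
    (hb : 0 < b) (hat : 0 < a + γ * t)
    (F0 f0 : ℝ → ℝ) (hf0 : ∀ x, HasDerivAt F0 (f0 x) x) (hf0pos : ∀ x, 0 ≤ f0 x)
    (hF0bot : Filter.Tendsto F0 Filter.atBot (nhds 0))
    (hF0top : Filter.Tendsto F0 Filter.atTop (nhds 1)) :
    ∫⁻ y, ENNReal.ofReal (k * (1 / γ) * (f0 y / (1 - F0 y)) *
        ((1 - F0 y) ^ (1 / γ)) ^ a * (1 - (1 - F0 y) ^ (1 / γ)) ^ (b - 1)) *
        ENNReal.ofReal (Real.exp (t * Real.log (1 - F0 y)))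
      = ENNReal.ofReal (k * betaFn (a + γ * t) b) := by
  have hmono : Monotone F0 := monotone_of_hasDerivAt_nonneg hf0 hf0pos
  have hcont : Continuous F0 := continuous_iff_continuousAt.2 fun x => (hf0 x).continuousAt
  have h0 : ∀ y, 0 ≤ F0 y := fun y => hmono.le_of_tendsto hF0bot y
  have h1 : ∀ y, F0 y ≤ 1 := fun y => hmono.ge_of_tendsto hF0top y
  set s : Set ℝ := F0 ⁻¹' Ioo 0 1 with hs
  have hsm : MeasurableSet s := hcont.measurable measurableSet_Ioo
  have hoff : ∀ y, y ∉ s → f0 y = 0 := by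
    intro y hy
    rcases (h0 y).eq_or_lt with h | h
    · have : IsLocalMin F0 y := Filter.Eventually.of_forall fun x => by rw [← h]; exact h0 x
      exact this.hasDerivAt_eq_zero (hf0 y)
    · have h' : F0 y = 1 := by
        by_contra hne
        exact hy ⟨h, lt_of_le_of_ne (h1 y) hne⟩
      have : IsLocalMax F0 y := Filter.Eventually.of_forall fun x => by
        show F0 x ≤ F0 y
        rw [h']; exact h1 x
      exact this.hasDerivAt_eq_zero (hf0 y)
  set U : ℝ → ℝ := fun y => (1 - F0 y) ^ (1 / γ) with hU
  have hg1 : 0 < 1 / γ := by positivity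
  have himg : U '' s = Ioo 0 1 := by
    ext u
    constructor
    · rintro ⟨y, hy, rfl⟩
      have p1 : 0 < 1 - F0 y := by linarith [hy.2]
      have p2 : 1 - F0 y < 1 := by linarith [hy.1]
      exact ⟨Real.rpow_pos_of_pos p1 _, Real.rpow_lt_one p1.le p2 hg1⟩
    · rintro ⟨hu0, hu1⟩
      have q0 : 0 < u ^ γ := Real.rpow_pos_of_pos hu0 _
      have q1 : u ^ γ < 1 := Real.rpow_lt_one hu0.le hu1 hγ
      have : 1 - u ^ γ ∈ range F0 := by
        obtain ⟨x, hx⟩ := ((hF0bot.eventually (gt_mem_nhds (show (0:ℝ) < 1 - u ^ γ by linarith)))).exists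
        obtain ⟨x', hx'⟩ := ((hF0top.eventually (lt_mem_nhds (show 1 - u ^ γ < 1 by linarith)))).exists
        exact mem_range_of_exists_le_of_exists_ge hcont ⟨x, hx.le⟩ ⟨x', hx'.le⟩
      obtain ⟨y, hy⟩ := this
      refine ⟨y, ?_, ?_⟩
      · rw [hs, mem_preimage, hy]; constructor <;> linarith
      · simp only [hU, hy]
        rw [sub_sub_cancel, ← Real.rpow_mul hu0.le, mul_one_div_cancel hγ.ne', Real.rpow_one]
  have hU' : ∀ y ∈ s, HasDerivWithinAt U (-(f0 y) * (1 / γ) * (1 - F0 y) ^ (1 / γ - 1)) s y := by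
    intro y hy
    have p1 : 0 < 1 - F0 y := by linarith [hy.2]
    exact (((hf0 y).const_sub 1).rpow_const (Or.inl p1.ne')).hasDerivWithinAt
  have hanti : AntitoneOn U s := by
    intro x hx y hy hxy
    exact Real.rpow_le_rpow (by linarith [h1 y]) (by linarith [hmono hxy]) hg1.le
  have key := lintegral_image_eq_lintegral_deriv_mul_of_antitoneOn hsm hU' hanti
    (fun u => ENNReal.ofReal (k * (u ^ (a + γ * t - 1) * (1 - u) ^ (b - 1))))
  rw [himg] at key
  simp_rw [ENNReal.ofReal_mul hk] at key
  rw [lintegral_const_mul' _ _ ENNReal.ofReal_ne_top, aux_beta _ _ hat hb] at key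
  rw [ENNReal.ofReal_mul hk, key, ← lintegral_indicator hsm]
  refine lintegral_congr fun y => ?_
  by_cases hy : y ∈ s
  · rw [indicator_of_mem hy]
    have p1 : 0 < 1 - F0 y := by linarith [hy.2]
    have p2 : 1 - F0 y < 1 := by linarith [hy.1]
    have u0 : 0 < U y := Real.rpow_pos_of_pos p1 _
    have u1 : U y < 1 := Real.rpow_lt_one p1.le p2 hg1
    have hf := hf0pos y
    rw [← ENNReal.ofReal_mul hk, ← ENNReal.ofReal_mul' (Real.exp_nonneg _),
      ← ENNReal.ofReal_mul' (by have := sub_pos.2 u1; positivity)]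
    congr 1
    have e1 : (1 - F0 y) ^ (1 / γ - 1) = U y / (1 - F0 y) := by
      rw [Real.rpow_sub p1, Real.rpow_one]
    have e2 : Real.exp (t * Real.log (1 - F0 y)) = U y ^ (γ * t) := by
      rw [hU]; simp only
      rw [← Real.rpow_mul p1.le, Real.rpow_def_of_pos p1]
      congr 1
      field_simp
    have e3 : U y ^ (a + γ * t - 1) = U y ^ a * U y ^ (γ * t) / U y := by
      rw [Real.rpow_sub u0, Real.rpow_add u0, Real.rpow_one]
    rw [e1, e2, e3]
    change k * (1 / γ) * (f0 y / (1 - F0 y)) * U y ^ a * (1 - U y) ^ (b - 1) * U y ^ (γ * t) = _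
    field_simp
  · rw [indicator_of_notMem hy, hoff y hy]
    simp

lemma aux_an (x : ℝ) (hx : 0 < x) : AnalyticAt ℝ (fun t => Real.log (Real.Gamma t)) x := by
  have h : AnalyticAt ℂ Complex.Gamma (x : ℂ) := by
    rw [Complex.analyticAt_iff_eventually_differentiableAt]
    have : ∀ᶠ z : ℂ in nhds (x : ℂ), 0 < z.re :=
      Complex.continuous_re.continuousAt.eventually (lt_mem_nhds (by simpa using hx))
    filter_upwards [this] with z hz
    refine Complex.differentiableAt_Gamma z fun m hm => ?_
    rw [hm] at hz
    simp at hz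
    linarith [(Nat.cast_nonneg m : (0:ℝ) ≤ m)]
  have h2 : AnalyticAt ℝ Real.Gamma x := h.re_ofReal
  exact h2.log (Real.Gamma_pos_of_pos hx)

lemma aux_d1 (x : ℝ) (hx : 0 < x) :
    HasDerivAt (fun t => Real.log (Real.Gamma t)) (digamma x) x :=
  (aux_an x hx).differentiableAt.hasDerivAt

lemma aux_d2 (x : ℝ) (hx : 0 < x) : HasDerivAt digamma (trigamma x) x :=
  (aux_an x hx).deriv.differentiableAt.hasDerivAt

lemma aux_betaFn_exp (a b : ℝ) (ha : 0 < a) (hb : 0 < b) : betaFn a b =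
    Real.Gamma b * Real.exp (Real.log (Real.Gamma a) - Real.log (Real.Gamma (a + b))) := by
  rw [Real.exp_sub, Real.exp_log (Real.Gamma_pos_of_pos ha),
    Real.exp_log (Real.Gamma_pos_of_pos (add_pos ha hb)), betaFn]
  ring

lemma aux_b1 (a b : ℝ) (ha : 0 < a) (hb : 0 < b) :
    HasDerivAt (fun s => betaFn s b) (betaFn a b * (digamma a - digamma (a + b))) a := by
  have h := (((aux_d1 a ha).sub ((aux_d1 (a + b) (add_pos ha hb)).comp_add_const a b)).exp).const_mul
    (Real.Gamma b)
  refine (h.congr_of_eventuallyEq ?_).congr_deriv ?_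
  · filter_upwards [lt_mem_nhds ha] with s hs
    exact aux_betaFn_exp s b hs hb
  · rw [aux_betaFn_exp a b ha hb]
    simp only [Pi.sub_apply]
    ring

lemma aux_b2 (a b : ℝ) (ha : 0 < a) (hb : 0 < b) :
    HasDerivAt (fun s => betaFn s b * (digamma s - digamma (s + b)))
      (betaFn a b * ((digamma a - digamma (a + b)) ^ 2 + trigamma a - trigamma (a + b))) a := by
  have h := (aux_b1 a b ha hb).mul
    ((aux_d2 a ha).sub ((aux_d2 (a + b) (add_pos ha hb)).comp_add_const a b))
  refine h.congr_deriv ?_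
  simp only [Pi.sub_apply]
  ring

open Set Filter Topology in
/-- With the setup of Statement 14 (RNS complete-data observation `Y` from
the PHR model with set size `k` and indicator `z`),
`E[(log (1 - F0 Y))²] = γ² k B(α-1, β+1) ((ψ(α-1) - ψ(α+β))² + ψ'(α-1) - ψ'(α+β))`. -/
theorem phr_rns_second_moment_log_survival
    {Ω : Type*} [MeasureSpace Ω] [IsProbabilityMeasure (ℙ : Measure Ω)]
    (γ : ℝ) (hγ : 0 < γ) (k : ℕ) (hk : 1 ≤ k) (z : ℝ) (hz : z = 0 ∨ z = 1)
    (α β : ℝ) (hα : α = (1 - z) * (k - 1) + 2) (hβ : β = z * (k - 1))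
    (F0 f0 : ℝ → ℝ) (hf0 : ∀ x, HasDerivAt F0 (f0 x) x) (hf0pos : ∀ x, 0 ≤ f0 x)
    (hF0bot : Filter.Tendsto F0 Filter.atBot (nhds 0))
    (hF0top : Filter.Tendsto F0 Filter.atTop (nhds 1))
    (Y : Ω → ℝ) (hY : Measurable Y)
    (hdens : Measure.map Y ℙ = volume.withDensity (fun y => ENNReal.ofReal
      ((k : ℝ) * (1 / γ) * (f0 y / (1 - F0 y)) *
        ((1 - F0 y) ^ (1 / γ)) ^ (α - 1) * (1 - (1 - F0 y) ^ (1 / γ)) ^ β))) :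
    (∫ ω, (Real.log (1 - F0 (Y ω))) ^ 2 ∂ℙ) =
      γ ^ 2 * (k : ℝ) * betaFn (α - 1) (β + 1) *
        ((digamma (α - 1) - digamma (α + β)) ^ 2 + trigamma (α - 1) - trigamma (α + β)) := by
  have hk1 : (1 : ℝ) ≤ k := by exact_mod_cast hk
  have hb : 0 < β + 1 := by
    rcases hz with rfl | rfl <;> rw [hβ] <;> linarith
  have ha : 0 < α - 1 := by
    rcases hz with rfl | rfl <;> rw [hα] <;> linarith
  obtain ⟨a, rfl⟩ : ∃ a, α = a + 1 := ⟨α - 1, by ring⟩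
  obtain ⟨b, rfl⟩ : ∃ b, β = b - 1 := ⟨β + 1, by ring⟩
  have E1 : a + 1 - 1 = a := by ring
  have E2 : b - 1 + 1 = b := by ring
  have E3 : a + 1 + (b - 1) = a + b := by ring
  rw [E1] at ha hdens ⊢
  rw [E2] at hb ⊢
  rw [E3]
  clear hα hβ
  have hcont : Continuous F0 := continuous_iff_continuousAt.2 fun x => (hf0 x).continuousAt
  have hF : Measurable F0 := hcont.measurable
  have hf : Measurable f0 := by
    have : f0 = deriv F0 := funext fun x => (hf0 x).deriv.symm
    rw [this]; exact measurable_deriv F0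
  set X : Ω → ℝ := fun ω => Real.log (1 - F0 (Y ω)) with hX
  have hXm : Measurable X := by fun_prop
  have hl : ∀ t, 0 < a + γ * t →
      ∫⁻ ω, ENNReal.ofReal (Real.exp (t * X ω)) ∂ℙ = ENNReal.ofReal (k * betaFn (a + γ * t) b) := by
    intro t ht
    rw [← aux_cov γ hγ k (by linarith) a b t hb ht F0 f0 hf0 hf0pos hF0bot hF0top]
    have h1 := lintegral_map (μ := (ℙ : Measure Ω))
      (f := fun y => ENNReal.ofReal (Real.exp (t * Real.log (1 - F0 y)))) (by fun_prop) hY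
    rw [← h1, hdens, lintegral_withDensity_eq_lintegral_mul _ (by fun_prop) (by fun_prop)]
    rfl
  have hint : ∀ t, 0 < a + γ * t → Integrable (fun ω => Real.exp (t * X ω)) ℙ := by
    intro t ht
    refine ⟨by fun_prop, ?_⟩
    rw [hasFiniteIntegral_iff_ofReal (Eventually.of_forall fun _ => Real.exp_nonneg _), hl t ht]
    exact ENNReal.ofReal_lt_top
  have hm : ∀ t, 0 < a + γ * t → mgf X ℙ t = k * betaFn (a + γ * t) b := by
    intro t ht
    rw [mgf, integral_eq_lintegral_of_nonneg_ae (Eventually.of_forall fun _ => Real.exp_nonneg _)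
      (by fun_prop), hl t ht, ENNReal.toReal_ofReal]
    have := beta_pos ht hb
    have e : betaFn (a + γ * t) b = beta (a + γ * t) b := rfl
    rw [e]; positivity
  have hopen : IsOpen {t : ℝ | 0 < a + γ * t} := isOpen_lt (by fun_prop) (by fun_prop)
  have hsub : {t : ℝ | 0 < a + γ * t} ⊆ interior (integrableExpSet X ℙ) :=
    interior_maximal (fun t ht => hint t ht) hopen
  have h00 : (0:ℝ) ∈ {t : ℝ | 0 < a + γ * t} := by simpa using ha
  have hin : ∀ t : ℝ, HasDerivAt (fun t => a + γ * t) γ t := fun t => by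
    simpa using ((hasDerivAt_id t).const_mul γ).const_add a
  have D1 : ∀ t, 0 < a + γ * t → deriv (mgf X ℙ) t =
      k * γ * (betaFn (a + γ * t) b * (digamma (a + γ * t) - digamma (a + γ * t + b))) := by
    intro t ht
    have h := ((aux_b1 (a + γ * t) b ht hb).comp t (hin t)).const_mul (k : ℝ)
    have h2 : mgf X ℙ =ᶠ[𝓝 t] fun t => (k : ℝ) * ((fun s => betaFn s b) ∘ fun t => a + γ * t) t := by
      filter_upwards [hopen.mem_nhds ht] with s hs
      exact hm s hs
    rw [(h.congr_of_eventuallyEq h2).deriv]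
    ring
  have D2 : deriv (deriv (mgf X ℙ)) 0 = k * γ * (betaFn a b *
      ((digamma a - digamma (a + b)) ^ 2 + trigamma a - trigamma (a + b)) * γ) := by
    have ha0 : a + γ * 0 = a := by ring
    have h := ((aux_b2 (a + γ * 0) b (by rwa [ha0]) hb).comp 0 (hin 0)).const_mul (k * γ : ℝ)
    have h2 : deriv (mgf X ℙ) =ᶠ[𝓝 0] fun t => (k * γ : ℝ) *
        ((fun s => betaFn s b * (digamma s - digamma (s + b))) ∘ fun t => a + γ * t) t := by
      filter_upwards [hopen.mem_nhds h00] with s hs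
      exact D1 s hs
    rw [(h.congr_of_eventuallyEq h2).deriv, ha0]
  have fin := iteratedDeriv_mgf_zero (hsub h00) 2
  rw [iteratedDeriv_succ, iteratedDeriv_one, D2] at fin
  calc _ = ∫ ω, (X ^ 2) ω ∂ℙ := rfl
    _ = _ := fin.symm
    _ = _ := by ring
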